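/- The vector x⋆ : Fin N → ℝ defined by x⋆ j = Δ(A, b)/2 + x̄(A, b) j attains the Chebyshev error Δ(A, b)/2, i.e. max over i of |max over j of (A i j + x⋆ j) − b i| = Δ(A, b)/2; hence x⋆ is a best approximate solution of the max-plus equation A ⊗ x = b. -/

import Mathlib

open Finset

/-- Finite maximum over `Fin n` (nonempty since `NeZero n`). -/
noncomputable def fmax {n : ℕ} [NeZero n] (f : Fin n → ℝ) : ℝ :=
  Finset.univ.sup' Finset.univ_nonempty f

/-- Finite minimum over `Fin n`. -/
noncomputable def fmin {n : ℕ} [NeZero n] (f : Fin n → ℝ) : ℝ :=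
  Finset.univ.inf' Finset.univ_nonempty f

/-- Max-plus matrix-vector product: `(A ⊗ x) i = max_j (A i j + x j)`. -/
noncomputable def mp {M N : ℕ} [NeZero N] (A : Fin M → Fin N → ℝ) (x : Fin N → ℝ) :
    Fin M → ℝ :=
  fun i => fmax (fun j => A i j + x j)

/-- Tropical (Chebyshev) distance. -/
noncomputable def dd {M : ℕ} [NeZero M] (u v : Fin M → ℝ) : ℝ :=
  fmax (fun i => |u i - v i|)

/-- Residual `Δ(A, b)`. -/
noncomputable def resid {M N : ℕ} [NeZero M] [NeZero N]
    (A : Fin M → Fin N → ℝ) (b : Fin M → ℝ) : ℝ :=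
  fmax (fun i => b i - fmax (fun j => A i j + fmin (fun k => b k - A k j)))

/-- Principal solution `x̄(A, b) j = min_i (b i − A i j)`. -/
noncomputable def xbar {M N : ℕ} [NeZero M]
    (A : Fin M → Fin N → ℝ) (b : Fin M → ℝ) : Fin N → ℝ :=
  fun j => fmin (fun i => b i - A i j)

theorem le_fmax {n : ℕ} [NeZero n] (f : Fin n → ℝ) (i : Fin n) : f i ≤ fmax f :=
  Finset.le_sup' f (Finset.mem_univ i)

theorem fmax_le_iff {n : ℕ} [NeZero n] {f : Fin n → ℝ} {c : ℝ} : fmax f ≤ c ↔ ∀ i, f i ≤ c := by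
  simp [fmax]

theorem fmin_le {n : ℕ} [NeZero n] (f : Fin n → ℝ) (i : Fin n) : fmin f ≤ f i :=
  Finset.inf'_le f (Finset.mem_univ i)

theorem le_fmin_iff {n : ℕ} [NeZero n] {f : Fin n → ℝ} {c : ℝ} : c ≤ fmin f ↔ ∀ i, c ≤ f i := by
  simp [fmin]

theorem mp_le_iff {M N : ℕ} [NeZero N] {A : Fin M → Fin N → ℝ} {x : Fin N → ℝ} {i : Fin M}
    {c : ℝ} : mp A x i ≤ c ↔ ∀ j, A i j + x j ≤ c :=
  fmax_le_iff

theorem le_mp {M N : ℕ} [NeZero N] (A : Fin M → Fin N → ℝ) (x : Fin N → ℝ) (i : Fin M)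
    (j : Fin N) : A i j + x j ≤ mp A x i :=
  le_fmax (fun j => A i j + x j) j

theorem mp_const_add {M N : ℕ} [NeZero N] (A : Fin M → Fin N → ℝ) (x : Fin N → ℝ) (c : ℝ)
    (i : Fin M) : mp A (fun j => c + x j) i = c + mp A x i := by
  apply le_antisymm
  · rw [mp_le_iff]
    intro j
    linarith [le_mp A x i j]
  · rw [← le_sub_iff_add_le', mp_le_iff]
    intro j
    linarith [le_mp A (fun j => c + x j) i j]

/-- The principal solution is a subsolution of `A ⊗ x = b`. -/
theorem mp_xbar_le {M N : ℕ} [NeZero M] [NeZero N] (A : Fin M → Fin N → ℝ) (b : Fin M → ℝ)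
    (i : Fin M) : mp A (xbar A b) i ≤ b i := by
  rw [mp_le_iff]
  intro j
  have h : xbar A b j ≤ b i - A i j := fmin_le (fun i => b i - A i j) i
  linarith

theorem sub_mp_xbar_le_resid {M N : ℕ} [NeZero M] [NeZero N] (A : Fin M → Fin N → ℝ)
    (b : Fin M → ℝ) (i : Fin M) : b i - mp A (xbar A b) i ≤ resid A b :=
  le_fmax (fun i => b i - mp A (xbar A b) i) i

/-- No vector approximates `b` with Chebyshev error smaller than half the residual. -/
theorem half_resid_le_dd {M N : ℕ} [NeZero M] [NeZero N] (A : Fin M → Fin N → ℝ)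
    (b : Fin M → ℝ) (x : Fin N → ℝ) : resid A b / 2 ≤ dd (mp A x) b := by
  have hdist (i : Fin M) : |mp A x i - b i| ≤ dd (mp A x) b :=
    le_fmax (fun i => |mp A x i - b i|) i
  have hx (j : Fin N) : x j - dd (mp A x) b ≤ xbar A b j := by
    refine le_fmin_iff.2 fun i => ?_
    linarith [le_mp A x i j, (abs_le.1 (hdist i)).2]
  have hresid : resid A b ≤ 2 * dd (mp A x) b := by
    refine fmax_le_iff.2 fun i => ?_
    change b i - mp A (xbar A b) i ≤ _
    have hmp : mp A x i ≤ mp A (xbar A b) i + dd (mp A x) b := by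
      rw [mp_le_iff]
      intro j
      linarith [le_mp A (xbar A b) i j, hx j]
    linarith [(abs_le.1 (hdist i)).1]
  linarith

/-- Shifting the principal solution by half the residual gives error at most half the residual. -/
theorem dd_shifted_xbar_le {M N : ℕ} [NeZero M] [NeZero N] (A : Fin M → Fin N → ℝ)
    (b : Fin M → ℝ) : dd (mp A (fun j => resid A b / 2 + xbar A b j)) b ≤ resid A b / 2 := by
  refine fmax_le_iff.2 fun i => ?_
  rw [mp_const_add, abs_le]
  constructor <;> linarith [mp_xbar_le A b i, sub_mp_xbar_le_resid A b i]

/-- `x⋆ j = Δ(A,b)/2 + x̄(A,b) j` attains Chebyshev error `Δ(A,b)/2`,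
hence is a best approximate solution of `A ⊗ x = b`. -/
theorem maxplus_best_approximate_solution (M N : ℕ) [NeZero M] [NeZero N]
    (A : Fin M → Fin N → ℝ) (b : Fin M → ℝ) :
    dd (mp A (fun j => resid A b / 2 + xbar A b j)) b = resid A b / 2 ∧
      ∀ x : Fin N → ℝ,
        dd (mp A (fun j => resid A b / 2 + xbar A b j)) b ≤ dd (mp A x) b := by
  exact ⟨(dd_shifted_xbar_le A b).antisymm (half_resid_le_dd A b _),
    fun x => (dd_shifted_xbar_le A b).trans (half_resid_le_dd A b x)⟩
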